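/- Let E be a complex Banach space and let ζ : ℂ → E be a function that is complex differentiable at every point z with Re z > 0 and bounded on {z : Re z > 0} (i.e. there is C ≥ 0 with ‖ζ(z)‖ ≤ C whenever Re z > 0). Suppose there is a strictly monotone sequence (a_k)_{k∈ℕ} of real numbers with a_k > 1 for every k, such that the series ∑_k 1/a_k diverges (k ↦ 1/a_k is not summable) and ζ(a_k) = 0 for every k. Then ζ(z) = 0 for every z with Re z > 0. -/

import Mathlib

open Complex

open Filter Topology Metric

/-- The inverse Cayley transform `w ↦ a (1 + w) / (1 - w)` maps the unit disk into the right
half-plane. -/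
lemma re_mul_one_add_div_one_sub_pos {a : ℝ} (ha : 0 < a) {w : ℂ} (hw : ‖w‖ < 1) :
    0 < ((a : ℂ) * ((1 + w) / (1 - w))).re := by
  have hne : 1 - w ≠ 0 := by
    intro h
    rw [← sub_eq_zero.mp h] at hw
    simp at hw
  have hn : 0 < normSq (1 - w) := normSq_pos.mpr hne
  have hw2 : normSq w < 1 := by
    rw [normSq_eq_norm_sq]
    nlinarith [norm_nonneg w]
  rw [re_ofReal_mul, div_re, ← add_div]
  refine mul_pos ha (div_pos ?_ hn)
  rw [normSq_apply] at hw2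
  simp only [add_re, sub_re, one_re, add_im, sub_im, one_im]
  nlinarith

lemma norm_sub_sq_eq_norm_add_sq_sub (z : ℂ) (a : ℝ) :
    ‖z - a‖ ^ 2 = ‖z + a‖ ^ 2 - 4 * a * z.re := by
  simp only [← normSq_eq_norm_sq, normSq_apply, sub_re, sub_im, add_re, add_im, ofReal_re,
    ofReal_im]
  ring

lemma norm_add_ofReal_pos {z : ℂ} (hz : 0 < z.re) {a : ℝ} (ha : 0 < a) : 0 < ‖z + a‖ := by
  refine norm_pos_iff.mpr fun h => ?_
  have := congrArg re h
  simp only [add_re, ofReal_re, zero_re] at this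
  linarith

section

variable {E : Type*} [NormedAddCommGroup E] [NormedSpace ℂ E]

/-- The **Schwarz lemma** on the right half-plane. -/
lemma norm_le_mul_norm_sub_div_norm_add {f : ℂ → E}
    (hf : ∀ z : ℂ, 0 < z.re → DifferentiableAt ℂ f z) {C : ℝ}
    (hC : ∀ z : ℂ, 0 < z.re → ‖f z‖ ≤ C) {a : ℝ} (ha : 0 < a) (hfa : f a = 0)
    {z : ℂ} (hz : 0 < z.re) : ‖f z‖ ≤ C * (‖z - a‖ / ‖z + a‖) := by
  set F : ℂ → E := fun w => f ((a : ℂ) * ((1 + w) / (1 - w))) with hF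
  have hF0 : F 0 = 0 := by simp [hF, hfa]
  have hd : DifferentiableOn ℂ F (ball 0 1) := by
    intro w hw
    have hw' : ‖w‖ < 1 := mem_ball_zero_iff.mp hw
    have hne : 1 - w ≠ 0 := by
      intro h
      rw [← sub_eq_zero.mp h] at hw'
      simp at hw'
    have hg : DifferentiableAt ℂ (fun w : ℂ => (a : ℂ) * ((1 + w) / (1 - w))) w := by
      fun_prop (disch := exact hne)
    exact (DifferentiableAt.comp w (hf _ (re_mul_one_add_div_one_sub_pos ha hw')) hg
      ).differentiableWithinAt
  have hm : Set.MapsTo F (ball 0 1) (closedBall (F 0) C) := by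
    intro w hw
    rw [hF0, mem_closedBall_zero_iff]
    exact hC _ (re_mul_one_add_div_one_sub_pos ha (mem_ball_zero_iff.mp hw))
  have hpos := norm_add_ofReal_pos hz ha
  have hne : z + a ≠ 0 := norm_pos_iff.mp hpos
  have ha' : (a : ℂ) ≠ 0 := ofReal_ne_zero.mpr ha.ne'
  have hw : (z - a) / (z + a) ∈ ball (0 : ℂ) 1 := by
    rw [mem_ball_zero_iff, norm_div, div_lt_one hpos]
    refine lt_of_pow_lt_pow_left₀ 2 hpos.le ?_
    rw [norm_sub_sq_eq_norm_add_sq_sub]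
    have := mul_pos ha hz
    linarith
  have key := dist_le_div_mul_dist_of_mapsTo_ball hd hm hw
  have hz' : (a : ℂ) * ((1 + (z - a) / (z + a)) / (1 - (z - a) / (z + a))) = z := by
    have h1 : 1 + (z - a) / (z + a) = 2 * z / (z + a) := by field_simp; ring
    have h2 : 1 - (z - a) / (z + a) = 2 * a / (z + a) := by field_simp; ring
    rw [h1, h2]
    field_simp
  rw [hF0, dist_zero_right, dist_zero_right, div_one, norm_div] at key
  simpa only [hF, hz'] using key

/-- A zero `a > 0` of a bounded holomorphic function on the right half-plane can be divided out by
the Blaschke factor `(z - a) / (z + a)` without increasing the bound. -/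
lemma exists_eq_blaschke_smul [CompleteSpace E] {f : ℂ → E}
    (hf : ∀ z : ℂ, 0 < z.re → DifferentiableAt ℂ f z) {C : ℝ}
    (hC : ∀ z : ℂ, 0 < z.re → ‖f z‖ ≤ C) {a : ℝ} (ha : 0 < a) (hfa : f a = 0) :
    ∃ g : ℂ → E, (∀ z : ℂ, 0 < z.re → DifferentiableAt ℂ g z) ∧
      (∀ z : ℂ, 0 < z.re → ‖g z‖ ≤ C) ∧
      ∀ z : ℂ, 0 < z.re → f z = ((z - a) / (z + a)) • g z := by
  have hopen : IsOpen {z : ℂ | 0 < z.re} := isOpen_lt continuous_const continuous_re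
  have hmem : (a : ℂ) ∈ {z : ℂ | 0 < z.re} := by simpa using ha
  have hds : DifferentiableOn ℂ (dslope f a) {z : ℂ | 0 < z.re} :=
    (differentiableOn_dslope (hopen.mem_nhds hmem)).mpr
      fun z hz => (hf z hz).differentiableWithinAt
  have hg : ∀ z : ℂ, 0 < z.re → DifferentiableAt ℂ (fun z : ℂ => (z + a) • dslope f a z) z :=
    fun z hz => (differentiableAt_id.add_const _).smul (hds.differentiableAt (hopen.mem_nhds hz))
  have hfg : ∀ z : ℂ, 0 < z.re → f z = ((z - a) / (z + a)) • (z + a) • dslope f a z := by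
    intro z hz
    rw [smul_smul, div_mul_cancel₀ _ (norm_pos_iff.mp (norm_add_ofReal_pos hz ha)),
      sub_smul_dslope, hfa, sub_zero]
  have hne : ∀ z : ℂ, 0 < z.re → z ≠ a → ‖(z + a) • dslope f a z‖ ≤ C := by
    intro z hz hza
    have h := norm_le_mul_norm_sub_div_norm_add hf hC ha hfa hz
    rw [hfg z hz, norm_smul, norm_div, mul_comm C] at h
    exact le_of_mul_le_mul_left h
      (div_pos (norm_pos_iff.mpr (sub_ne_zero.mpr hza)) (norm_add_ofReal_pos hz ha))
  refine ⟨fun z => (z + a) • dslope f a z, hg, fun z hz => ?_, hfg⟩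
  by_cases hza : z = a
  · subst hza
    refine le_of_tendsto ((hg _ hz).continuousAt.norm.tendsto.mono_left
      (nhdsWithin_le_nhds (s := {(a : ℂ)}ᶜ))) ?_
    filter_upwards [self_mem_nhdsWithin, nhdsWithin_le_nhds (hopen.mem_nhds hz)] with w hw hw'
    exact hne w hw' hw
  · exact hne z hz hza

/-- A bounded holomorphic function on the right half-plane is dominated by the finite Blaschke
products of its positive zeros. -/
lemma norm_le_mul_prod_blaschke [CompleteSpace E] {C : ℝ} (n : ℕ) {f : ℂ → E}
    (hf : ∀ z : ℂ, 0 < z.re → DifferentiableAt ℂ f z)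
    (hC : ∀ z : ℂ, 0 < z.re → ‖f z‖ ≤ C) {a : ℕ → ℝ} (hinj : Function.Injective a)
    (ha : ∀ k, 0 < a k) (hzero : ∀ k, f (a k) = 0) {z : ℂ} (hz : 0 < z.re) :
    ‖f z‖ ≤ C * ∏ k ∈ Finset.range n, ‖z - a k‖ / ‖z + a k‖ := by
  induction n generalizing f a with
  | zero => simpa using hC z hz
  | succ n ih =>
    obtain ⟨g, hg, hgC, hfg⟩ := exists_eq_blaschke_smul hf hC (ha 0) (hzero 0)
    have hgz : ∀ k, g (a (k + 1)) = 0 := by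
      intro k
      have hre : 0 < ((a (k + 1) : ℝ) : ℂ).re := ha (k + 1)
      have h := hfg _ hre
      rw [hzero, eq_comm, smul_eq_zero] at h
      refine h.resolve_left (div_ne_zero (sub_ne_zero.mpr fun h' => ?_)
        (norm_pos_iff.mp (norm_add_ofReal_pos hre (ha 0))))
      exact Nat.succ_ne_zero k (hinj (ofReal_injective h'))
    have h := ih hg hgC (a := fun k => a (k + 1))
      (hinj.comp (add_left_injective 1)) (fun k => ha _) hgz
    rw [hfg z hz, norm_smul, norm_div, Finset.prod_range_succ', ← mul_assoc, mul_comm]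
    exact mul_le_mul_of_nonneg_right h (by positivity)

end

/-- The Blaschke factor of `a ≥ 1` at `z` is exponentially small in `1 / a`. -/
lemma sq_norm_sub_div_norm_add_le_exp {z : ℂ} (hz : 0 < z.re) {a : ℝ} (ha : 1 ≤ a) :
    (‖z - a‖ / ‖z + a‖) ^ 2 ≤ Real.exp (-(4 * z.re / (1 + ‖z‖) ^ 2 * (1 / a))) := by
  have ha0 : 0 < a := by linarith
  have hpos := norm_add_ofReal_pos hz ha0
  have hle : ‖z + a‖ ≤ a * (1 + ‖z‖) := by
    have h := norm_add_le z (a : ℂ)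
    rw [norm_real, Real.norm_of_nonneg ha0.le] at h
    nlinarith [norm_nonneg z]
  have hfrac : 4 * z.re / (1 + ‖z‖) ^ 2 * (1 / a) ≤ 4 * a * z.re / ‖z + a‖ ^ 2 := by
    calc 4 * z.re / (1 + ‖z‖) ^ 2 * (1 / a) = 4 * a * z.re / (a * (1 + ‖z‖)) ^ 2 := by
          field_simp
      _ ≤ _ := by gcongr
  have heq : (‖z - a‖ / ‖z + a‖) ^ 2 = 1 - 4 * a * z.re / ‖z + a‖ ^ 2 := by
    rw [div_pow, norm_sub_sq_eq_norm_add_sq_sub]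
    field_simp
  rw [heq]
  linarith [Real.add_one_le_exp (-(4 * z.re / (1 + ‖z‖) ^ 2 * (1 / a)))]

/-- a bounded holomorphic Banach-valued function on the open right
half-plane vanishing on a strictly monotone sequence `a k > 1` with `∑ 1/a k = ∞`
vanishes identically on the right half-plane. -/
theorem holomorphic_vanishing_on_half_plane
    {E : Type*} [NormedAddCommGroup E] [NormedSpace ℂ E] [CompleteSpace E]
    (ζ : ℂ → E)
    (hdiff : ∀ z : ℂ, 0 < z.re → DifferentiableAt ℂ ζ z)
    (hbd : ∃ C : ℝ, 0 ≤ C ∧ ∀ z : ℂ, 0 < z.re → ‖ζ z‖ ≤ C)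
    (a : ℕ → ℝ) (hmono : StrictMono a ∨ StrictAnti a)
    (ha : ∀ k, 1 < a k)
    (hdiv : ¬ Summable (fun k => 1 / a k))
    (hzero : ∀ k, ζ (a k) = 0) :
    ∀ z : ℂ, 0 < z.re → ζ z = 0 := by
  intro z hz
  obtain ⟨C, -, hC⟩ := hbd
  have hinj : Function.Injective a := hmono.elim StrictMono.injective StrictAnti.injective
  have ha0 : ∀ k, 0 < a k := fun k => zero_lt_one.trans (ha k)
  set c : ℝ := 4 * z.re / (1 + ‖z‖) ^ 2 with hc
  have hcpos : 0 < c := by positivity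
  have hbound : ∀ n, ‖ζ z‖ ^ 2 ≤
      C ^ 2 * Real.exp (-(c * ∑ k ∈ Finset.range n, 1 / a k)) := by
    intro n
    calc ‖ζ z‖ ^ 2 ≤ (C * ∏ k ∈ Finset.range n, ‖z - a k‖ / ‖z + a k‖) ^ 2 :=
          pow_le_pow_left₀ (norm_nonneg _)
            (norm_le_mul_prod_blaschke n hdiff hC hinj ha0 hzero hz) 2
      _ = C ^ 2 * ∏ k ∈ Finset.range n, (‖z - a k‖ / ‖z + a k‖) ^ 2 := by
          rw [mul_pow, Finset.prod_pow]
      _ ≤ C ^ 2 * ∏ k ∈ Finset.range n, Real.exp (-(c * (1 / a k))) := by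
          gcongr with k
          exact sq_norm_sub_div_norm_add_le_exp hz (ha k).le
      _ = _ := by rw [← Real.exp_sum, Finset.sum_neg_distrib, Finset.mul_sum]
  have hsum : Tendsto (fun n => ∑ k ∈ Finset.range n, 1 / a k) atTop atTop :=
    (not_summable_iff_tendsto_nat_atTop_of_nonneg
      fun k => (one_div_pos.mpr (ha0 k)).le).mp hdiv
  have hlim : Tendsto (fun n => C ^ 2 * Real.exp (-(c * ∑ k ∈ Finset.range n, 1 / a k)))
      atTop (𝓝 0) := by
    simpa using (Real.tendsto_exp_neg_atTop_nhds_zero.comp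
      (hsum.const_mul_atTop hcpos)).const_mul (C ^ 2)
  have hle : ‖ζ z‖ ^ 2 ≤ 0 := ge_of_tendsto' hlim hbound
  exact norm_eq_zero.mp (pow_eq_zero_iff two_ne_zero |>.mp (le_antisymm hle (sq_nonneg _)))
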